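/- Let 0 < Ω < π, s ∈ ℤ, m ∈ ℕ, and let x : ℤ → ℂ be square-summable. Let z ∈ ℂ^{m+1} be given by z_p = Σ_{t∈ℤ\M_s} h(s+p−t) x(t) for p ∈ {0, ..., m}. Then Σ_{p=0}^{m} |z_p|² ≤ Σ_{t∈ℤ\M_s} |x(t)|². -/

import Mathlib

open Real Set

/-- Ideal low-pass filter kernel: `h(n) = sin(Ω n)/(π n)` for `n ≠ 0`, `h(0) = Ω/π`. -/
noncomputable def lowPass (Ω : ℝ) (n : ℤ) : ℝ :=
  if n = 0 then Ω / Real.pi else Real.sin (Ω * n) / (Real.pi * n)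

/-- `Ms s m` is the block of missing points `{s, s+1, ..., s+m}`. -/
def Ms (s : ℤ) (m : ℕ) : Set ℤ := Set.Icc s (s + m)

lemma lp_integral (Ω : ℝ) (n : ℤ) :
    ∫ θ in (-Ω)..Ω, Complex.exp (Complex.I * n * θ) = ((2 * Real.pi * lowPass Ω n : ℝ) : ℂ) := by
  have hpi : (Real.pi : ℂ) ≠ 0 := by exact_mod_cast Real.pi_ne_zero
  unfold lowPass
  split_ifs with h
  · subst h
    simp
    field_simp
    ring
  · have hn : (n : ℂ) ≠ 0 := by exact_mod_cast h
    rw [integral_exp_mul_complex (mul_ne_zero Complex.I_ne_zero hn)]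
    push_cast
    rw [Complex.sin]
    have e1 : Complex.I * n * (Ω : ℂ) = Ω * n * Complex.I := by ring
    have e2 : Complex.I * n * (-(Ω : ℂ)) = -(Ω * n) * Complex.I := by ring
    rw [e1, e2]
    field_simp
    rw [Complex.I_sq]
    ring

lemma lp_pi (n : ℤ) : lowPass Real.pi n = if n = 0 then 1 else 0 := by
  unfold lowPass
  split_ifs with h
  · exact div_self Real.pi_ne_zero
  · rw [mul_comm, Real.sin_int_mul_pi, zero_div]

noncomputable def trigP {ι : Type*} (A : Finset ι) (k : ι → ℤ) (a : ι → ℂ) (θ : ℝ) : ℂ :=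
  ∑ p ∈ A, a p * Complex.exp (-(Complex.I * k p * θ))

lemma trigP_cont {ι : Type*} (A : Finset ι) (k : ι → ℤ) (a : ι → ℂ) :
    Continuous (trigP A k a) := by
  unfold trigP
  fun_prop

lemma trigP_integral {ι κ : Type*} (A : Finset ι) (B : Finset κ) (k : ι → ℤ) (l : κ → ℤ)
    (a : ι → ℂ) (b : κ → ℂ) (Ω : ℝ) :
    ∫ θ in (-Ω)..Ω, (starRingEnd ℂ) (trigP A k a θ) * trigP B l b θ =
      2 * Real.pi * ∑ p ∈ A, (starRingEnd ℂ) (a p) *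
        ∑ t ∈ B, (lowPass Ω (k p - l t) : ℂ) * b t := by
  have h1 : ∀ θ : ℝ, (starRingEnd ℂ) (trigP A k a θ) * trigP B l b θ =
      ∑ p ∈ A, ∑ t ∈ B, ((starRingEnd ℂ) (a p) * b t) *
        Complex.exp (Complex.I * ((k p - l t : ℤ) : ℂ) * θ) := by
    intro θ
    unfold trigP
    rw [map_sum, Finset.sum_mul_sum]
    refine Finset.sum_congr rfl fun p _ => Finset.sum_congr rfl fun t _ => ?_
    rw [map_mul, ← Complex.exp_conj]
    have : Complex.exp (Complex.I * ((k p - l t : ℤ) : ℂ) * θ) =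
      Complex.exp ((starRingEnd ℂ) (-(Complex.I * k p * θ))) *
        Complex.exp (-(Complex.I * l t * θ)) := by
      rw [← Complex.exp_add]
      congr 1
      simp
      ring
    rw [this]
    ring
  simp_rw [h1]
  rw [intervalIntegral.integral_finsetSum]
  · rw [Finset.mul_sum]
    refine Finset.sum_congr rfl fun p _ => ?_
    rw [intervalIntegral.integral_finsetSum]
    · rw [Finset.mul_sum, Finset.mul_sum]
      refine Finset.sum_congr rfl fun t _ => ?_
      rw [intervalIntegral.integral_const_mul, lp_integral]
      push_cast
      ring
    · intro t _
      apply Continuous.intervalIntegrable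
      fun_prop
  · intro p _
    apply Continuous.intervalIntegrable
    fun_prop

lemma trigP_norm {ι : Type*} (A : Finset ι) (k : ι → ℤ) (hk : Function.Injective k) (a : ι → ℂ) :
    ∫ θ in (-Real.pi)..Real.pi, ‖trigP A k a θ‖ ^ 2 = 2 * Real.pi * ∑ p ∈ A, ‖a p‖ ^ 2 := by
  classical
  have h := trigP_integral A A k k a a Real.pi
  have h2 : ∀ p ∈ A, (starRingEnd ℂ) (a p) *
        ∑ t ∈ A, (lowPass Real.pi (k p - k t) : ℂ) * a t = ((‖a p‖ ^ 2 : ℝ) : ℂ) := by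
    intro p hp
    rw [Finset.sum_eq_single p]
    · rw [lp_pi]
      simp [Complex.conj_mul']
    · intro t _ ht
      rw [lp_pi, if_neg]
      · simp
      · intro h0
        exact ht (hk (by omega))
    · intro h; exact absurd hp h
  rw [Finset.sum_congr rfl h2] at h
  simp_rw [Complex.conj_mul'] at h
  have h3 : ∫ θ in (-Real.pi)..Real.pi, ((‖trigP A k a θ‖ : ℂ)) ^ 2 =
      ((∫ θ in (-Real.pi)..Real.pi, ‖trigP A k a θ‖ ^ 2 : ℝ) : ℂ) := by
    rw [← intervalIntegral.integral_ofReal]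
    simp
  rw [h3] at h
  exact_mod_cast h

lemma trigP_finite {ι κ : Type*} (A : Finset ι) (B : Finset κ) (k : ι → ℤ) (l : κ → ℤ)
    (hk : Function.Injective k) (hl : Function.Injective l) (b : κ → ℂ) (Ω : ℝ)
    (h0 : 0 < Ω) (hΩ : Ω < Real.pi) :
    ∑ p ∈ A, ‖∑ t ∈ B, (lowPass Ω (k p - l t) : ℂ) * b t‖ ^ 2 ≤ ∑ t ∈ B, ‖b t‖ ^ 2 := by
  set a : ι → ℂ := fun p => ∑ t ∈ B, (lowPass Ω (k p - l t) : ℂ) * b t with ha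
  have hcA := trigP_cont A k a
  have hcB := trigP_cont B l b
  have h := trigP_integral A B k l a b Ω
  have h2 : ∀ p ∈ A, (starRingEnd ℂ) (a p) *
        ∑ t ∈ B, (lowPass Ω (k p - l t) : ℂ) * b t = ((‖a p‖ ^ 2 : ℝ) : ℂ) := by
    intro p _
    change (starRingEnd ℂ) (a p) * a p = _
    simp [Complex.conj_mul']
  rw [Finset.sum_congr rfl h2] at h
  have h3 : 2 * Real.pi * ∑ p ∈ A, ‖a p‖ ^ 2 ≤
      ∫ θ in (-Ω)..Ω, ‖trigP A k a θ‖ * ‖trigP B l b θ‖ := by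
    have h4 := intervalIntegral.norm_integral_le_integral_norm (μ := MeasureTheory.volume)
      (f := fun θ => (starRingEnd ℂ) (trigP A k a θ) * trigP B l b θ)
      (show -Ω ≤ Ω by linarith)
    rw [h] at h4
    have h5 : (2 * Real.pi * ∑ p ∈ A, ((‖a p‖ ^ 2 : ℝ) : ℂ) : ℂ) =
      ((2 * Real.pi * ∑ p ∈ A, ‖a p‖ ^ 2 : ℝ) : ℂ) := by push_cast; rfl
    rw [h5, Complex.norm_real, Real.norm_eq_abs] at h4
    simp only [norm_mul, RCLike.norm_conj] at h4
    exact (le_abs_self _).trans h4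
  have h6 : ∫ θ in (-Ω)..Ω, ‖trigP A k a θ‖ * ‖trigP B l b θ‖ ≤
      ∫ θ in (-Ω)..Ω, (‖trigP A k a θ‖ ^ 2 + ‖trigP B l b θ‖ ^ 2) / 2 := by
    apply intervalIntegral.integral_mono_on (by linarith)
    · apply Continuous.intervalIntegrable; fun_prop
    · apply Continuous.intervalIntegrable; fun_prop
    · intro θ _
      nlinarith [sq_nonneg (‖trigP A k a θ‖ - ‖trigP B l b θ‖)]
  have h7 : ∫ θ in (-Ω)..Ω, (‖trigP A k a θ‖ ^ 2 + ‖trigP B l b θ‖ ^ 2) / 2 ≤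
      ∫ θ in (-Real.pi)..Real.pi, (‖trigP A k a θ‖ ^ 2 + ‖trigP B l b θ‖ ^ 2) / 2 := by
    apply intervalIntegral.integral_mono_interval (by linarith) (by linarith) hΩ.le
    · exact Filter.Eventually.of_forall fun θ => by positivity
    · apply Continuous.intervalIntegrable; fun_prop
  replace h7 := (h3.trans h6).trans h7
  rw [intervalIntegral.integral_div, intervalIntegral.integral_add, trigP_norm A k hk,
    trigP_norm B l hl] at h7
  · have hpi := Real.pi_pos
    have h8 : Real.pi * ∑ p ∈ A, ‖a p‖ ^ 2 ≤ Real.pi * ∑ t ∈ B, ‖b t‖ ^ 2 := by linarith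
    exact le_of_mul_le_mul_left h8 hpi
  · apply Continuous.intervalIntegrable; fun_prop
  · apply Continuous.intervalIntegrable; fun_prop

theorem z_vector_norm_bound (Ω : ℝ) (hΩ0 : 0 < Ω) (hΩπ : Ω < Real.pi)
    (s : ℤ) (m : ℕ) (x : ℤ → ℂ) (hx : Summable fun t : ℤ => ‖x t‖ ^ 2) :
    ∑ p : Fin (m + 1),
      ‖∑' t : {t : ℤ // t ∉ Ms s m},
        (lowPass Ω (s + (p : ℤ) - (t : ℤ)) : ℂ) * x (t : ℤ)‖ ^ 2 ≤
      ∑' t : {t : ℤ // t ∉ Ms s m}, ‖x (t : ℤ)‖ ^ 2 := by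
  classical
  have hx' : Summable fun t : {t : ℤ // t ∉ Ms s m} => ‖x (t : ℤ)‖ ^ 2 :=
    hx.comp_injective Subtype.val_injective
  set f : Fin (m + 1) → {t : ℤ // t ∉ Ms s m} → ℂ := fun p t =>
    (lowPass Ω (s + (p : ℤ) - (t : ℤ)) : ℂ) * x (t : ℤ) with hf
  set A : Finset (Fin (m + 1)) := Finset.univ.filter fun p => Summable (f p) with hA
  -- terms that are not summable contribute zero
  have e : ∑ p : Fin (m + 1), ‖∑' t, f p t‖ ^ 2 = ∑ p ∈ A, ‖∑' t, f p t‖ ^ 2 := by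
    symm
    apply Finset.sum_subset (Finset.subset_univ _)
    intro p _ hp
    have : ¬ Summable (f p) := by simpa [hA] using hp
    rw [tsum_eq_zero_of_not_summable this]
    simp
  change ∑ p : Fin (m + 1), ‖∑' t, f p t‖ ^ 2 ≤ _
  rw [e]
  have ht : Filter.Tendsto (fun B : Finset {t : ℤ // t ∉ Ms s m} =>
      ∑ p ∈ A, ‖∑ t ∈ B, f p t‖ ^ 2) Filter.atTop (nhds (∑ p ∈ A, ‖∑' t, f p t‖ ^ 2)) := by
    apply tendsto_finsetSum
    intro p hp
    have hs : Summable (f p) := by simpa [hA] using hp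
    have h1 : Filter.Tendsto (fun B : Finset {t : ℤ // t ∉ Ms s m} => ∑ t ∈ B, f p t)
      Filter.atTop (nhds (∑' t, f p t)) := hs.hasSum
    exact h1.norm.pow 2
  refine le_of_tendsto ht (Filter.Eventually.of_forall fun B => ?_)
  refine (trigP_finite A B (fun p : Fin (m + 1) => s + (p : ℤ)) Subtype.val ?_
    Subtype.val_injective (fun t => x t) Ω hΩ0 hΩπ).trans ?_
  · intro p q h
    apply Fin.ext
    simpa using h
  · exact hx'.sum_le_tsum B fun t _ => by positivity
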